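/- For every natural number k, the following identity of polynomials in q holds: Σ over pairs (P, w), where P is a Dyck path of length 2k and w assigns to each up step of P starting at height h a weight in {1, −q^{h+1}}, such that P has no peak (an up step immediately followed by a down step) whose up step is assigned weight 1, of the product over all up steps of their assigned weights, equals (−1)^k · q^{k(k+1)/2}. -/

import Mathlib

open Finset

inductive Step : Type
  | U | L | D
deriving DecidableEq

instance : Fintype Step where
  elems := Finset.mk ([Step.U, Step.L, Step.D] : List Step) (by decide)
  complete := by intro x; cases x <;> decide

/-- The vertical displacement of a step: up = +1, level = 0, down = -1. -/
def Step.val : Step → ℤ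
  | .U => 1
  | .L => 0
  | .D => -1

/-- The partial sum of the step values of the first `i` steps;
this is the height at which step `i` starts. -/
def hsum {n : ℕ} (P : Fin n → Step) (i : ℕ) : ℤ :=
  ∑ j ∈ Finset.univ.filter (fun j : Fin n => (j : ℕ) < i), (P j).val

/-- A Motzkin path: all partial sums nonnegative and total sum 0. -/
abbrev IsMotzkin {n : ℕ} (P : Fin n → Step) : Prop :=
  (∀ i : Fin (n+1), 0 ≤ hsum P (i : ℕ)) ∧ hsum P n = 0

/-- A Motzkin prefix of final height `k`: all partial sums nonnegative, total sum `k`. -/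
abbrev IsMPrefix {n : ℕ} (P : Fin n → Step) (k : ℕ) : Prop :=
  (∀ i : Fin (n+1), 0 ≤ hsum P (i : ℕ)) ∧ hsum P n = (k : ℤ)

/-- `[h]_q = 1 + q + ... + q^(h-1)`. -/
def geo {R : Type*} [CommSemiring R] (q : R) (h : ℤ) : R :=
  ∑ i ∈ Finset.range h.toNat, q ^ i

/-- The Gaussian (q-)binomial coefficient, via the q-Pascal recurrence. -/
def qbinom {R : Type*} [CommSemiring R] (q : R) : ℕ → ℕ → R
  | _, 0 => 1
  | 0, _+1 => 0
  | n+1, k+1 => qbinom q n k + q ^ (k+1) * qbinom q n (k+1)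

/-- The binomial coefficient with integer lower argument, zero on negative arguments. -/
def ch (m : ℕ) (j : ℤ) : ℤ := if 0 ≤ j then m.choose j.toNat else 0


namespace Penaud
open Polynomial

lemma hsum_zero {n : ℕ} (P : Fin n → Step) : hsum P 0 = 0 := by
  simp [hsum]

lemma hsum_cons {n : ℕ} (s : Step) (P : Fin n → Step) (i : ℕ) :
    hsum (Fin.cons s P : Fin (n+1) → Step) (i+1) = s.val + hsum P i := by
  simp only [hsum, Finset.sum_filter]
  rw [Fin.sum_univ_succ]
  simp

def Cond {n : ℕ} (h : ℤ) (b : Bool) (P : Fin n → Step) (w : Fin n → Bool) : Prop :=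
  (∀ i : ℕ, i ≤ n → 0 ≤ h + hsum P i) ∧ h + hsum P n = 0 ∧ (∀ i, P i ≠ Step.L) ∧
  (∀ i, P i ≠ Step.U → w i = true) ∧
  (∀ i j : Fin n, (j : ℕ) = (i : ℕ) + 1 → ¬(P i = Step.U ∧ P j = Step.D ∧ w i = true)) ∧
  (b = true → ∀ i : Fin n, (i : ℕ) = 0 → P i ≠ Step.D)

noncomputable def wt {n : ℕ} (h : ℤ) (P : Fin n → Step) (w : Fin n → Bool) : Polynomial ℤ :=
  ∏ i : Fin n, (if P i = Step.U then
              (if w i then 1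
               else -(X : Polynomial ℤ) ^ ((h + hsum P (i : ℕ)).toNat + 1))
            else 1)

lemma wt_cons {n : ℕ} (h : ℤ) (s : Step) (c : Bool) (P : Fin n → Step) (w : Fin n → Bool) :
    wt h (Fin.cons s P : Fin (n+1) → Step) (Fin.cons c w : Fin (n+1) → Bool) =
    (if s = Step.U then (if c then 1 else -(X : Polynomial ℤ) ^ (h.toNat + 1)) else 1)
      * wt (h + s.val) P w := by
  unfold wt
  rw [Fin.prod_univ_succ]
  simp [hsum_zero, hsum_cons, add_assoc]

lemma all_cons {n : ℕ} (h : ℤ) (s : Step) (P : Fin n → Step) :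
    (∀ i : ℕ, i ≤ n+1 → 0 ≤ h + hsum (Fin.cons s P : Fin (n+1) → Step) i) ↔
    0 ≤ h ∧ ∀ i : ℕ, i ≤ n → 0 ≤ (h + s.val) + hsum P i := by
  constructor
  · intro H
    refine ⟨by simpa [hsum_zero] using H 0 (by omega), fun i hi => ?_⟩
    have := H (i+1) (by omega)
    rw [hsum_cons] at this
    omega
  · rintro ⟨h0, H⟩ i hi
    cases i with
    | zero => simpa [hsum_zero] using h0
    | succ i =>
      have := H i (by omega)
      rw [hsum_cons]
      omega

lemma peak_cons {n : ℕ} (s : Step) (c : Bool) (P : Fin n → Step) (w : Fin n → Bool) :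
    (∀ i j : Fin (n+1), (j : ℕ) = (i : ℕ) + 1 →
      ¬((Fin.cons s P : Fin (n+1) → Step) i = Step.U ∧ (Fin.cons s P : Fin (n+1) → Step) j = Step.D
        ∧ (Fin.cons c w : Fin (n+1) → Bool) i = true)) ↔
    (s = Step.U ∧ c = true → ∀ i : Fin n, (i : ℕ) = 0 → P i ≠ Step.D) ∧
    (∀ i j : Fin n, (j : ℕ) = (i : ℕ) + 1 → ¬(P i = Step.U ∧ P j = Step.D ∧ w i = true)) := by
  simp only [Fin.forall_fin_succ, Fin.cons_zero, Fin.cons_succ, Fin.val_zero, Fin.val_succ]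
  constructor
  · rintro ⟨⟨_, H1⟩, H2⟩
    refine ⟨fun ⟨hs, hc⟩ i hi hd => H1 i (by omega) ⟨hs, hd, hc⟩, fun i j hij => (H2 i).2 j (by omega)⟩
  · rintro ⟨H1, H2⟩
    refine ⟨⟨by simp, fun i hi ⟨hs, hd, hc⟩ => H1 ⟨hs, hc⟩ i (by omega) hd⟩, fun i => ⟨by simp, fun j hij => H2 i j (by omega)⟩⟩

lemma cond_cons {n : ℕ} (h : ℤ) (hh : 0 ≤ h) (b : Bool) (s : Step) (c : Bool)
    (P : Fin n → Step) (w : Fin n → Bool) :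
    Cond h b (Fin.cons s P : Fin (n+1) → Step) (Fin.cons c w : Fin (n+1) → Bool) ↔
    s ≠ Step.L ∧ (s ≠ Step.U → c = true) ∧ (b = true → s ≠ Step.D) ∧
      Cond (h + s.val) (decide (s = Step.U) && c) P w := by
  unfold Cond
  rw [all_cons, peak_cons, hsum_cons]
  simp only [Fin.forall_fin_succ, Fin.cons_zero, Fin.cons_succ, Fin.val_zero, Fin.val_succ]
  simp only [Bool.and_eq_true, decide_eq_true_eq, add_assoc]
  simp
  tauto

open Classical in
noncomputable def S (n : ℕ) (h : ℤ) (b : Bool) : Polynomial ℤ :=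
  ∑ P : Fin n → Step, ∑ w : Fin n → Bool, if Cond h b P w then wt h P w else 0

lemma sum_cons {α : Type} [Fintype α] [DecidableEq α] {n : ℕ} (f : (Fin (n+1) → α) → Polynomial ℤ) :
    ∑ P, f P = ∑ s : α, ∑ P : Fin n → α, f (Fin.cons s P) := by
  rw [← Fintype.sum_prod_type' (f := fun s (P : Fin n → α) => f (Fin.cons s P))]
  exact (Fintype.sum_equiv (Fin.consEquiv (fun _ => α)) _ _ (fun x => rfl)).symm

lemma sum_step (f : Step → Polynomial ℤ) : ∑ s, f s = f .U + f .L + f .D := by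
  have : (Finset.univ : Finset Step) = {.U, .L, .D} := by decide
  rw [this]
  simp [add_assoc]

lemma S_neg (n : ℕ) (h : ℤ) (hh : h < 0) (b : Bool) : S n h b = 0 := by
  unfold S
  refine Finset.sum_eq_zero fun P _ => Finset.sum_eq_zero fun w _ => if_neg fun H => ?_
  have := H.1 0 (by omega)
  rw [hsum_zero] at this
  omega

lemma S_zero (h : ℤ) (b : Bool) : S 0 h b = if h = 0 then 1 else 0 := by
  have : ∀ P w, Cond (n := 0) h b P w ↔ h = 0 := by
    intro P w
    simp only [Cond, hsum]
    simp
    intro h; omega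
  simp [S, this, wt]

open Classical in
lemma S_succ (n : ℕ) (h : ℕ) (b : Bool) :
    S (n+1) h b = -X^(h+1) * S n (h+1) false + S n (h+1) true
      + if b then 0 else S n (h-1) false := by
  have key : ∀ s c (P : Fin n → Step) (w : Fin n → Bool), _ := fun s c P w =>
    cond_cons (h : ℤ) (by omega) b s c P w
  have e : (h : ℤ) - 1 = h + -1 := rfl
  unfold S
  rw [sum_cons, sum_step]
  have key' : ∀ s c (P : Fin n → Step) (w : Fin n → Bool) (p : Polynomial ℤ),
      (if Cond (h : ℤ) b (Fin.cons s P : Fin (n+1) → Step) (Fin.cons c w : Fin (n+1) → Bool)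
        then p else 0) = if s ≠ Step.L ∧ (s ≠ Step.U → c = true) ∧ (b = true → s ≠ Step.D) then
        (if Cond (h + s.val) (decide (s = Step.U) && c) P w then p else 0) else 0 := by
    intro s c P w p
    rw [← ite_and]
    exact if_congr (by rw [key]; tauto) rfl rfl
  simp only [sum_cons (α := Bool), key', wt_cons, Fintype.sum_bool, Step.val, e]
  simp [Finset.sum_add_distrib, Finset.mul_sum, -neg_mul]
  cases b <;> simp [add_comm]

noncomputable def G : ℕ → ℕ → Polynomial ℤ
  | 0, _ => 1
  | _+1, 0 => 1
  | k+1, h+1 => G (k+1) h + X^(h+1) * G k (h+1)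

lemma G_zero (k : ℕ) : G k 0 = 1 := by cases k <;> simp [G]

lemma G_L2 (k : ℕ) (L1 : ∀ h, (1 - X^(h+1)) * G k (h+1) = (1 - X^(h+k+1)) * G k h) (h : ℕ) :
    (1 - X^(k+1)) * G (k+1) h = (1 - X^(h+k+1)) * G k h := by
  induction h with
  | zero => simp [G_zero]
  | succ h ih =>
    rw [G]
    linear_combination ih - L1 h

lemma G_L1 (k : ℕ) : ∀ h, (1 - X^(h+1)) * G k (h+1) = (1 - X^(h+k+1)) * G k h := by
  induction k with
  | zero => intro h; simp [G]
  | succ k ih =>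
    intro h
    have L2 := G_L2 k ih h
    rw [G]
    have := ih h
    linear_combination X^(h+1) * this - X^(h+1) * L2

/-- triangular numbers -/
def T : ℕ → ℕ
  | 0 => 0
  | k+1 => T k + (k+1)

lemma T_eq (k : ℕ) : k * (k+1) / 2 = T k := by
  have : k * (k+1) = 2 * T k := by
    induction k with
    | zero => rfl
    | succ k ih => simp only [T]; linarith
  omega

lemma S_true (n : ℕ) (h : ℕ) : S (n+1) h true = S (n+1) h false - S n (h-1) false := by
  rw [S_succ, S_succ]; simp

lemma S_small (n : ℕ) : ∀ (h : ℕ) (b : Bool), n < h → S n h b = 0 := by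
  induction n with
  | zero => intro h b hh; rw [S_zero, if_neg (by omega)]
  | succ n ih =>
    intro h b hh
    rw [S_succ]
    obtain ⟨h, rfl⟩ : ∃ h', h = h' + 1 := ⟨h - 1, by omega⟩
    have e1 := ih (h+1+1) false (by omega)
    have e2 := ih (h+1+1) true (by omega)
    have e3 := ih h false (by omega)
    push_cast at *
    simp [e1, e2, e3]

lemma S_closed (n : ℕ) : ∀ h k : ℕ, n = h + 2 * k →
    S n h false = (-1)^k * X^(T k) * G k h := by
  induction n using Nat.strong_induction_on with
  | _ n IH =>
  intro h k hn
  match n, k, h with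
  | 0, k, h =>
    obtain rfl : h = 0 := by omega
    obtain rfl : k = 0 := by omega
    rw [S_zero]; simp [T, G]
  | n+1, 0, 0 => omega
  | n+1, 0, h+1 =>
    rw [S_succ]
    have e1 := S_small n (h+1+1) false (by omega)
    have e2 := S_small n (h+1+1) true (by omega)
    have e3 := IH n (by omega) h 0 (by omega)
    push_cast at *
    simp [e1, e2, e3, T, G]
  | 1, k+1, h => omega
  | n+2, k+1, 0 =>
    rw [S_succ]
    have e := S_true n 1
    have e1 := IH (n+1) (by omega) 1 k (by omega)
    have e2 := IH n (by omega) 0 k (by omega)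
    have e3 := S_neg (n+1) (-1) (by omega) false
    have L := G_L1 k 0
    simp [G_zero] at *
    rw [e, e1, e2, e3]
    simp only [T]
    linear_combination (-1)^k * X^(T k) * L
  | n+2, k+1, h+1 =>
    rw [S_succ]
    have e := S_true n (h+1+1)
    have e1 := IH (n+1) (by omega) (h+1+1) k (by omega)
    have e2 := IH n (by omega) (h+1) k (by omega)
    have e3 := IH (n+1) (by omega) h (k+1) (by omega)
    have L := G_L1 k (h+1)
    push_cast at *
    have q1 : (h : ℤ) + 1 + 1 - 1 = h + 1 := by ring
    have q2 : (h : ℤ) + 1 - 1 = h := by ring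
    rw [e, e1, q1, q2, e2]
    rw [e3]
    simp only [T, G] at *
    linear_combination (-1)^k * X^(T k) * L

end Penaud

open Polynomial in
/-- Penaud's lemma: the total weight of labelled Dyck paths of length `2k`
(up steps labelled `1` or `-q^(h+1)`, no peak whose up step is labelled `1`)
is `(-1)^k q^(k(k+1)/2)`.  The label `w` is canonically `true` off up steps. -/
theorem stmt13 (k : ℕ) :
    (∑ pw ∈ Finset.univ.filter
        (fun pw : (Fin (2*k) → Step) × (Fin (2*k) → Bool) =>
          IsMotzkin pw.1 ∧ (∀ i, pw.1 i ≠ Step.L) ∧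
          (∀ i, pw.1 i ≠ Step.U → pw.2 i = true) ∧
          ∀ i j : Fin (2*k), (j : ℕ) = (i : ℕ) + 1 →
            ¬(pw.1 i = Step.U ∧ pw.1 j = Step.D ∧ pw.2 i = true)),
      ∏ i, (if pw.1 i = Step.U then
              (if pw.2 i then 1
               else -(X : Polynomial ℤ) ^ ((hsum pw.1 (i : ℕ)).toNat + 1))
            else 1))
    = (-1 : Polynomial ℤ) ^ k * X ^ (k * (k+1) / 2) := by
  classical
  have key := Penaud.S_closed (2*k) 0 k (by omega)
  rw [Penaud.G_zero, ← Penaud.T_eq, mul_one] at key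
  rw [← key, Penaud.S, ← Fintype.sum_prod_type', Finset.sum_filter]
  refine Finset.sum_congr rfl fun pw _ => ?_
  have hc : (IsMotzkin pw.1 ∧ (∀ i, pw.1 i ≠ Step.L) ∧
          (∀ i, pw.1 i ≠ Step.U → pw.2 i = true) ∧
          ∀ i j : Fin (2*k), (j : ℕ) = (i : ℕ) + 1 →
            ¬(pw.1 i = Step.U ∧ pw.1 j = Step.D ∧ pw.2 i = true)) ↔
      Penaud.Cond ((0 : ℕ) : ℤ) false pw.1 pw.2 := by
    unfold Penaud.Cond IsMotzkin
    constructor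
    · rintro ⟨⟨a, b⟩, c, d, e⟩
      exact ⟨fun i hi => by simpa using a ⟨i, by omega⟩, by simpa using b, c, d, e, by simp⟩
    · rintro ⟨a, b, c, d, e, -⟩
      exact ⟨⟨fun i => by simpa using a i (by omega), by simpa using b⟩, c, d, e⟩
  simp only [hc, Penaud.wt, Nat.cast_zero, zero_add]
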